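/- arXiv:2308.13455 — 2 statements merged into one kernel-verified Lean document; each statement's English description precedes it below -/
import Mathlib

section
/- Let 𝓗 be a hypergraph on a finite vertex set V, let p ∈ [0,1] and let γ ∈ (0, 1/10]. Writing μ := μ_p(𝓗) and Δ := Δ_p(𝓗), one has Pr(ν(𝓗[V_p]) ≤ γ²·μ) ≤ exp(−(1−γ)·μ + 2Δ). -/
open MeasureTheory

noncomputable def bern (p : ℝ) : Measure Bool :=
  (ENNReal.ofReal p) • Measure.dirac true + (ENNReal.ofReal (1 - p)) • Measure.dirac false

/-- The product Bernoulli measure on subsets of `V` (encoded as indicator functions):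
the `p`-random subset `V_p`. -/
noncomputable def pBern (V : Type*) [Fintype V] (p : ℝ) : Measure (V → Bool) :=
  Measure.pi fun _ => bern p

/-- `μ_p(𝓗) = Σ_{A ∈ 𝓗} p^{|A|}`. -/
noncomputable def muP {V : Type*} (p : ℝ) (H : Finset (Finset V)) : ℝ :=
  ∑ A ∈ H, p ^ A.card

/-- `Δ_p(𝓗) = Σ p^{|A ∪ B|}` over unordered pairs of distinct intersecting hyperedges. -/
noncomputable def deltaP {V : Type*} [DecidableEq V] (p : ℝ) (H : Finset (Finset V)) : ℝ :=
  (∑ A ∈ H, ∑ B ∈ H, if A ≠ B ∧ ¬ Disjoint A B then p ^ (A ∪ B).card else 0) / 2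

/-- The matching number `ν(𝓗)`: the largest size of a collection of pairwise disjoint
hyperedges. -/
noncomputable def matchNum {V : Type*} (H : Finset (Finset V)) : ℕ :=
  sSup {k | ∃ M ⊆ H, (↑M : Set (Finset V)).Pairwise (fun A B => Disjoint A B) ∧ M.card = k}

/-- The subhypergraph `𝓗[W]` induced by the set encoded by `ω`. -/
def inducedBy {V : Type*} (H : Finset (Finset V)) (ω : V → Bool) : Finset (Finset V) :=
  H.filter fun A => ∀ v ∈ A, ω v = true

section MatchingNumber

variable {V : Type*}

theorem card_le_matchNum {H M : Finset (Finset V)} (hM : M ⊆ H)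
    (hd : (↑M : Set (Finset V)).Pairwise (fun A B => Disjoint A B)) : M.card ≤ matchNum H := by
  refine le_csSup ⟨H.card, ?_⟩ ⟨M, hM, hd, rfl⟩
  rintro k ⟨N, hN, -, rfl⟩
  exact Finset.card_le_card hN

theorem exists_matching_card_eq (H : Finset (Finset V)) :
    ∃ M ⊆ H, (↑M : Set (Finset V)).Pairwise (fun A B => Disjoint A B) ∧ M.card = matchNum H := by
  refine Nat.sSup_mem (s := {k | ∃ M ⊆ H,
    (↑M : Set (Finset V)).Pairwise (fun A B => Disjoint A B) ∧ M.card = k})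
    ⟨0, ∅, by simp⟩ ⟨H.card, ?_⟩
  rintro k ⟨N, hN, -, rfl⟩
  exact Finset.card_le_card hN

theorem matchNum_mono {H K : Finset (Finset V)} (h : H ⊆ K) : matchNum H ≤ matchNum K := by
  obtain ⟨M, hM, hd, hc⟩ := exists_matching_card_eq H
  exact hc ▸ card_le_matchNum (hM.trans h) hd

theorem matchNum_empty : matchNum (∅ : Finset (Finset V)) = 0 := by
  obtain ⟨M, hM, -, hc⟩ := exists_matching_card_eq (∅ : Finset (Finset V))
  rw [← hc, Finset.subset_empty.1 hM, Finset.card_empty]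

theorem matchNum_add_one_le_of_disjoint {H K : Finset (Finset V)} {A : Finset V}
    (hA : A ∉ H) (hd : ∀ B ∈ H, Disjoint A B) (hK : H ⊆ K) (hAK : A ∈ K) :
    matchNum H + 1 ≤ matchNum K := by
  classical
  obtain ⟨M, hM, hp, hc⟩ := exists_matching_card_eq H
  rw [← hc, ← Finset.card_insert_of_notMem (fun h => hA (hM h))]
  refine card_le_matchNum (Finset.insert_subset hAK (hM.trans hK)) ?_
  rw [Finset.coe_insert]
  exact hp.insert_of_symm fun B hB _ => hd B (hM hB)

theorem mem_inducedBy {H : Finset (Finset V)} {ω : V → Bool} {A : Finset V} :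
    A ∈ inducedBy H ω ↔ A ∈ H ∧ ∀ v ∈ A, ω v = true :=
  Finset.mem_filter

theorem inducedBy_mono_left {H K : Finset (Finset V)} (h : H ⊆ K) (ω : V → Bool) :
    inducedBy H ω ⊆ inducedBy K ω :=
  Finset.filter_subset_filter _ h

theorem eq_true_of_le {ω ω' : V → Bool} (h : ω ≤ ω') {v : V} (hv : ω v = true) :
    ω' v = true :=
  le_antisymm (Bool.le_true _) (hv ▸ h v)

theorem inducedBy_mono_right (H : Finset (Finset V)) {ω ω' : V → Bool} (h : ω ≤ ω') :
    inducedBy H ω ⊆ inducedBy H ω' := by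
  intro A hA
  rw [mem_inducedBy] at hA ⊢
  exact ⟨hA.1, fun v hv => eq_true_of_le h (hA.2 v hv)⟩

end MatchingNumber

section Weights

variable {V : Type*} [Fintype V]

/-- The probability that the `p`-random subset is the set encoded by `ω`. -/
def bernWeight (p : ℝ) (ω : V → Bool) : ℝ :=
  ∏ v, if ω v = true then p else 1 - p

/-- The event that `A` is contained in the random subset, as a real-valued indicator. -/
def containsInd (A : Finset V) (ω : V → Bool) : ℝ :=
  if ∀ v ∈ A, ω v = true then 1 else 0

theorem bernWeight_nonneg {p : ℝ} (hp : p ∈ Set.Icc (0 : ℝ) 1) (ω : V → Bool) :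
    0 ≤ bernWeight p ω := by
  refine Finset.prod_nonneg fun v _ => ?_
  split_ifs
  · exact hp.1
  · linarith [hp.2]

theorem bernWeight_mul_bernWeight (p : ℝ) (ω ω' : V → Bool) :
    bernWeight p ω * bernWeight p ω' = bernWeight p (ω ⊓ ω') * bernWeight p (ω ⊔ ω') := by
  simp only [bernWeight, ← Finset.prod_mul_distrib]
  refine Finset.prod_congr rfl fun v _ => ?_
  rw [Pi.inf_apply, Pi.sup_apply]
  cases ω v <;> cases ω' v <;> simp [mul_comm]

theorem sum_bernWeight [DecidableEq V] (p : ℝ) : ∑ ω : V → Bool, bernWeight p ω = 1 := by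
  have h := Finset.prod_univ_sum (fun _ : V => (Finset.univ : Finset Bool))
    (fun _ b => if b = true then p else 1 - p)
  simp only [Fintype.piFinset_univ] at h
  rw [show (∑ ω : V → Bool, bernWeight p ω) = _ from h.symm]
  simp

theorem containsInd_nonneg (A : Finset V) (ω : V → Bool) : 0 ≤ containsInd A ω := by
  unfold containsInd; split_ifs <;> norm_num

theorem containsInd_mul_containsInd_le (A : Finset V) (ω ω' : V → Bool) :
    containsInd A ω * containsInd A ω' ≤ containsInd A (ω ⊓ ω') * containsInd A (ω ⊔ ω') := by
  by_cases h : (∀ v ∈ A, ω v = true) ∧ ∀ v ∈ A, ω' v = true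
  · have h1 : ∀ v ∈ A, (ω ⊓ ω') v = true := fun v hv => by simp [h.1 v hv, h.2 v hv]
    have h2 : ∀ v ∈ A, (ω ⊔ ω') v = true := fun v hv => by simp [h.1 v hv]
    unfold containsInd
    rw [if_pos h.1, if_pos h.2, if_pos h1, if_pos h2]
  · have h0 : containsInd A ω * containsInd A ω' = 0 := by
      unfold containsInd
      rw [not_and_or] at h
      rcases h with h | h <;> simp [if_neg h]
    rw [h0]
    exact mul_nonneg (containsInd_nonneg _ _) (containsInd_nonneg _ _)

variable [DecidableEq V]

theorem sum_bernWeight_mul_coord (p : ℝ) (v : V) (f : (V → Bool) → ℝ)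
    (hf : ∀ ω b, f (Function.update ω v b) = f ω) :
    ∑ ω, bernWeight p ω * ((if ω v = true then 1 else 0) * f ω) =
      p * ∑ ω, bernWeight p ω * f ω := by
  let flip : (V → Bool) → (V → Bool) := fun ω => Function.update ω v (!ω v)
  have hflip : Function.Involutive flip := fun ω => by
    simp [flip]
  have hw : ∀ ω : V → Bool, bernWeight p ω =
      (if ω v = true then p else 1 - p) *
        ∏ u ∈ Finset.univ.erase v, if ω u = true then p else 1 - p := fun ω =>
    (Finset.mul_prod_erase _ _ (Finset.mem_univ v)).symm
  have hrest : ∀ ω : V → Bool,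
      (∏ u ∈ Finset.univ.erase v, if flip ω u = true then p else 1 - p) =
        ∏ u ∈ Finset.univ.erase v, if ω u = true then p else 1 - p := fun ω =>
    Finset.prod_congr rfl fun u hu => by
      simp [flip, Function.update_of_ne (Finset.ne_of_mem_erase hu)]
  have key : ∑ ω, bernWeight p ω * ((if ω v = true then 0 else p) * f ω) =
      ∑ ω, bernWeight p ω * ((if ω v = true then 1 - p else 0) * f ω) := by
    rw [← Equiv.sum_comp (hflip.toPerm flip)]
    refine Finset.sum_congr rfl fun ω _ => ?_
    simp only [Function.Involutive.coe_toPerm]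
    rw [hw, hrest, hw ω, hf]
    cases h : ω v <;> simp [flip, h, mul_left_comm, mul_assoc]
  have : p * ∑ ω, bernWeight p ω * f ω =
      p * ∑ ω, bernWeight p ω * ((if ω v = true then 1 else 0) * f ω) +
        ∑ ω, bernWeight p ω * ((if ω v = true then 0 else p) * f ω) := by
    rw [Finset.mul_sum, Finset.mul_sum, ← Finset.sum_add_distrib]
    refine Finset.sum_congr rfl fun ω _ => ?_
    split_ifs <;> ring
  rw [this, key, Finset.mul_sum, ← Finset.sum_add_distrib]
  refine Finset.sum_congr rfl fun ω _ => ?_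
  split_ifs <;> ring

/-- A function not depending on the coordinates in `A` is independent of the event that `A` is
contained in the random subset. -/
theorem sum_bernWeight_mul_containsInd_mul (p : ℝ) (A : Finset V) (f : (V → Bool) → ℝ)
    (hf : ∀ v ∈ A, ∀ ω b, f (Function.update ω v b) = f ω) :
    ∑ ω, bernWeight p ω * (containsInd A ω * f ω) =
      p ^ A.card * ∑ ω, bernWeight p ω * f ω := by
  induction A using Finset.induction_on with
  | empty => simp [containsInd]
  | insert v A hv ih =>
    have hsplit : ∀ ω, containsInd (insert v A) ω * f ω =
        (if ω v = true then 1 else 0) * (containsInd A ω * f ω) := fun ω => by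
      simp only [containsInd, Finset.forall_mem_insert, ite_and]
      split_ifs <;> simp
    simp only [hsplit]
    rw [sum_bernWeight_mul_coord, ih fun u hu => hf u (Finset.mem_insert_of_mem hu),
      Finset.card_insert_of_notMem hv]
    · ring
    · intro ω b
      have : containsInd A (Function.update ω v b) = containsInd A ω := by
        unfold containsInd
        congr 1
        refine propext (forall₂_congr fun u hu => ?_)
        rw [Function.update_of_ne (ne_of_mem_of_not_mem hu hv)]
      rw [this, hf v (Finset.mem_insert_self _ _)]

theorem sum_bernWeight_mul_containsInd (p : ℝ) (A : Finset V) :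
    ∑ ω, bernWeight p ω * containsInd A ω = p ^ A.card := by
  simpa [sum_bernWeight] using
    sum_bernWeight_mul_containsInd_mul p A (fun _ => 1) (fun _ _ _ _ => rfl)

/-- Harris' inequality for decreasing functions, conditionally on `A` being contained in the
random subset. -/
theorem harris_antitone_containsInd {p : ℝ} (hp : p ∈ Set.Icc (0 : ℝ) 1) (A : Finset V)
    {f g : (V → Bool) → ℝ} (hf0 : 0 ≤ f) (hg0 : 0 ≤ g) (hf : Antitone f) (hg : Antitone g) :
    (∑ ω, bernWeight p ω * containsInd A ω * f ω) *
        (∑ ω, bernWeight p ω * containsInd A ω * g ω) ≤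
      p ^ A.card * ∑ ω, bernWeight p ω * containsInd A ω * (f ω * g ω) := by
  have h := fkg (α := (V → Bool)ᵒᵈ) (f := fun ω => f (OrderDual.ofDual ω))
    (g := fun ω => g (OrderDual.ofDual ω))
    (μ := fun ω => bernWeight p (OrderDual.ofDual ω) * containsInd A (OrderDual.ofDual ω))
    (fun ω => mul_nonneg (bernWeight_nonneg hp _) (containsInd_nonneg _ _))
    (fun ω => hf0 _) (fun ω => hg0 _) hf.dual_left hg.dual_left (fun a b => by
      have h1 := bernWeight_mul_bernWeight p (OrderDual.ofDual a) (OrderDual.ofDual b)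
      have h2 := containsInd_mul_containsInd_le A (OrderDual.ofDual a) (OrderDual.ofDual b)
      have h3 := mul_nonneg (bernWeight_nonneg hp (OrderDual.ofDual a))
        (bernWeight_nonneg hp (OrderDual.ofDual b))
      have h4 := mul_le_mul_of_nonneg_left h2 h3
      rw [ofDual_inf, ofDual_sup]
      calc _ = bernWeight p (OrderDual.ofDual a) * bernWeight p (OrderDual.ofDual b) *
            (containsInd A (OrderDual.ofDual a) * containsInd A (OrderDual.ofDual b)) := by ring
        _ ≤ _ := h4
        _ = _ := by rw [h1]; ring)
  rw [← sum_bernWeight_mul_containsInd p A]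
  exact h

end Weights

section Delta

variable {V : Type*} [DecidableEq V]

theorem deltaP_insert (p : ℝ) {A : Finset V} {H : Finset (Finset V)} (hA : A ∉ H) :
    deltaP p (insert A H) =
      deltaP p H + ∑ B ∈ H, if ¬ Disjoint A B then p ^ (A ∪ B).card else 0 := by
  have h1 : ∀ B ∈ H, (if A ≠ B ∧ ¬ Disjoint A B then p ^ (A ∪ B).card else 0) =
      if ¬ Disjoint A B then p ^ (A ∪ B).card else 0 := fun B hB => by
    have : A ≠ B := fun h => hA (h ▸ hB)
    simp [this]
  have h2 : ∀ B ∈ H, (if B ≠ A ∧ ¬ Disjoint B A then p ^ (B ∪ A).card else 0) =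
      if ¬ Disjoint A B then p ^ (A ∪ B).card else 0 := fun B hB => by
    have : B ≠ A := fun h => hA (h ▸ hB)
    simp [this, disjoint_comm, Finset.union_comm]
  unfold deltaP
  simp only [Finset.sum_insert hA, Finset.sum_add_distrib]
  rw [Finset.sum_congr rfl h1, Finset.sum_congr rfl h2]
  simp only [ne_eq, not_true_eq_false, false_and, if_false]
  ring

theorem deltaP_nonneg {p : ℝ} (hp : 0 ≤ p) (H : Finset (Finset V)) : 0 ≤ deltaP p H := by
  refine div_nonneg (Finset.sum_nonneg fun A _ => Finset.sum_nonneg fun B _ => ?_) zero_le_two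
  split_ifs
  · exact pow_nonneg hp _
  · exact le_rfl

end Delta

section Laplace

variable {V : Type*} [Fintype V] [DecidableEq V]

/-- The probability generating function of the matching number of the random induced
subhypergraph. -/
noncomputable def matchGen (p z : ℝ) (H : Finset (Finset V)) : ℝ :=
  ∑ ω : V → Bool, bernWeight p ω * z ^ matchNum (inducedBy H ω)

theorem matchGen_nonneg {p z : ℝ} (hp : p ∈ Set.Icc (0 : ℝ) 1) (hz0 : 0 ≤ z)
    (H : Finset (Finset V)) : 0 ≤ matchGen p z H :=
  Finset.sum_nonneg fun ω _ => mul_nonneg (bernWeight_nonneg hp ω) (pow_nonneg hz0 _)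

theorem matchGen_anti {p z : ℝ} (hp : p ∈ Set.Icc (0 : ℝ) 1) (hz0 : 0 ≤ z) (hz1 : z ≤ 1)
    {H K : Finset (Finset V)} (h : H ⊆ K) : matchGen p z K ≤ matchGen p z H :=
  Finset.sum_le_sum fun ω _ => mul_le_mul_of_nonneg_left
    (pow_le_pow_of_le_one hz0 hz1 (matchNum_mono (inducedBy_mono_left h ω)))
    (bernWeight_nonneg hp ω)

/-- The event that no hyperedge of `H` meeting `A` is contained in the random subset. -/
noncomputable def noNeighborInd (A : Finset V) (H : Finset (Finset V)) (ω : V → Bool) : ℝ :=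
  if ∃ B ∈ H, ¬ Disjoint A B ∧ ∀ v ∈ B, ω v = true then 0 else 1

theorem noNeighborInd_nonneg (A : Finset V) (H : Finset (Finset V)) : 0 ≤ noNeighborInd A H := by
  intro ω; unfold noNeighborInd; split_ifs <;> simp

theorem noNeighborInd_antitone (A : Finset V) (H : Finset (Finset V)) :
    Antitone (noNeighborInd A H) := by
  intro ω ω' h
  unfold noNeighborInd
  split_ifs with h1 h2 h2
  · exact le_rfl
  · exact zero_le_one
  · obtain ⟨B, hB, hd, hc⟩ := h2
    exact absurd ⟨B, hB, hd, fun v hv => eq_true_of_le h (hc v hv)⟩ h1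
  · exact le_rfl

theorem le_sum_noNeighborInd {p : ℝ} (hp : p ∈ Set.Icc (0 : ℝ) 1) (A : Finset V)
    (H : Finset (Finset V)) :
    p ^ A.card - ∑ B ∈ H, (if ¬ Disjoint A B then p ^ (A ∪ B).card else 0) ≤
      ∑ ω, bernWeight p ω * containsInd A ω * noNeighborInd A H ω := by
  have hB : ∀ B ∈ H, (if ¬ Disjoint A B then p ^ (A ∪ B).card else 0) =
      ∑ ω, bernWeight p ω * (if ¬ Disjoint A B then containsInd (A ∪ B) ω else 0) := by
    intro B _
    split_ifs
    · simp
    · exact (sum_bernWeight_mul_containsInd p _).symm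
  rw [Finset.sum_congr rfl hB, Finset.sum_comm, ← sum_bernWeight_mul_containsInd p A,
    ← Finset.sum_sub_distrib]
  refine Finset.sum_le_sum fun ω _ => ?_
  rw [← Finset.mul_sum, ← mul_sub, mul_assoc]
  refine mul_le_mul_of_nonneg_left ?_ (bernWeight_nonneg hp ω)
  have hnn : ∀ B ∈ H, 0 ≤ (if ¬ Disjoint A B then containsInd (A ∪ B) ω else 0) := fun B _ => by
    split_ifs
    · exact le_rfl
    · exact containsInd_nonneg _ _
  have hs := Finset.sum_nonneg hnn
  by_cases h : ∃ B ∈ H, ¬ Disjoint A B ∧ ∀ v ∈ B, ω v = true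
  · have h0 : noNeighborInd A H ω = 0 := if_pos h
    rw [h0, mul_zero]
    obtain ⟨B, hBH, hd, hc⟩ := h
    have h1 := Finset.single_le_sum hnn hBH
    rw [if_pos hd] at h1
    have h2 : containsInd A ω ≤ containsInd (A ∪ B) ω := by
      by_cases hA : ∀ v ∈ A, ω v = true
      · have : ∀ v ∈ A ∪ B, ω v = true := fun v hv =>
          (Finset.mem_union.1 hv).elim (hA v) (hc v)
        unfold containsInd
        rw [if_pos hA, if_pos this]
      · unfold containsInd
        rw [if_neg hA]
        exact containsInd_nonneg (A ∪ B) ω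
    linarith
  · have h1 : noNeighborInd A H ω = 1 := if_neg h
    rw [h1]
    linarith

theorem pow_matchNum_insert_le {z : ℝ} (hz0 : 0 ≤ z) (hz1 : z ≤ 1) {A : Finset V}
    {H : Finset (Finset V)} (hA : A ∉ H) (ω : V → Bool) :
    z ^ matchNum (inducedBy (insert A H) ω) ≤ z ^ matchNum (inducedBy H ω) - (1 - z) *
      (containsInd A ω * (z ^ matchNum (inducedBy (H.filter fun B => Disjoint A B) ω) *
        noNeighborInd A H ω)) := by
  have hmono : z ^ matchNum (inducedBy (insert A H) ω) ≤ z ^ matchNum (inducedBy H ω) :=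
    pow_le_pow_of_le_one hz0 hz1
      (matchNum_mono (inducedBy_mono_left (Finset.subset_insert _ _) ω))
  by_cases hc : ∀ v ∈ A, ω v = true
  · by_cases h : ∃ B ∈ H, ¬ Disjoint A B ∧ ∀ v ∈ B, ω v = true
    · have h0 : noNeighborInd A H ω = 0 := if_pos h
      rw [h0]
      simpa using hmono
    · have h1 : noNeighborInd A H ω = 1 := if_neg h
      have h2 : containsInd A ω = 1 := if_pos hc
      push Not at h
      have h3 : inducedBy (H.filter fun B => Disjoint A B) ω = inducedBy H ω := by
        ext B
        simp only [mem_inducedBy, Finset.mem_filter]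
        refine ⟨fun h => ⟨h.1.1, h.2⟩, fun hB => ⟨⟨hB.1, ?_⟩, hB.2⟩⟩
        by_contra hd
        obtain ⟨v, hv, hv'⟩ := h B hB.1 hd
        exact hv' (hB.2 v hv)
      have h4 : matchNum (inducedBy H ω) + 1 ≤ matchNum (inducedBy (insert A H) ω) := by
        refine matchNum_add_one_le_of_disjoint (A := A) (fun h => hA (mem_inducedBy.1 h).1) ?_
          (inducedBy_mono_left (Finset.subset_insert _ _) ω)
          (mem_inducedBy.2 ⟨Finset.mem_insert_self _ _, hc⟩)
        rw [← h3]
        intro B hB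
        exact (Finset.mem_filter.1 (mem_inducedBy.1 hB).1).2
      have h5 := pow_le_pow_of_le_one hz0 hz1 h4
      rw [h1, h2, h3]
      rw [pow_succ] at h5
      linarith
  · have h0 : containsInd A ω = 0 := if_neg hc
    rw [h0]
    simpa using hmono

theorem matchGen_mul_le_sum {p z : ℝ} (hp : p ∈ Set.Icc (0 : ℝ) 1) (hz0 : 0 ≤ z) (hz1 : z ≤ 1)
    (A : Finset V) (H : Finset (Finset V)) :
    matchGen p z H * (p ^ A.card - ∑ B ∈ H, if ¬ Disjoint A B then p ^ (A ∪ B).card else 0) ≤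
      ∑ ω, bernWeight p ω * containsInd A ω *
        (z ^ matchNum (inducedBy (H.filter fun B => Disjoint A B) ω) * noNeighborInd A H ω) := by
  set D := H.filter fun B => Disjoint A B
  have hharris := harris_antitone_containsInd hp A (f := fun ω => z ^ matchNum (inducedBy D ω))
    (fun ω => pow_nonneg hz0 _) (noNeighborInd_nonneg A H)
    (fun ω ω' h => pow_le_pow_of_le_one hz0 hz1 (matchNum_mono (inducedBy_mono_right D h)))
    (noNeighborInd_antitone A H)
  have hind : ∑ ω, bernWeight p ω * containsInd A ω * z ^ matchNum (inducedBy D ω) =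
      p ^ A.card * matchGen p z D := by
    simp only [mul_assoc]
    refine sum_bernWeight_mul_containsInd_mul p A _ fun v hv ω b => ?_
    have : inducedBy D (Function.update ω v b) = inducedBy D ω := by
      ext B
      rw [mem_inducedBy, mem_inducedBy]
      refine and_congr_right fun hB => forall₂_congr fun u hu => ?_
      have hd : Disjoint A B := (Finset.mem_filter.1 hB).2
      rw [Function.update_of_ne]
      rintro rfl
      exact Finset.disjoint_left.1 hd hv hu
    rw [this]
  have hQ := le_sum_noNeighborInd hp A H
  set Q := ∑ ω, bernWeight p ω * containsInd A ω * noNeighborInd A H ω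
  have hQ0 : 0 ≤ Q := Finset.sum_nonneg fun ω _ => mul_nonneg
    (mul_nonneg (bernWeight_nonneg hp ω) (containsInd_nonneg _ _)) (noNeighborInd_nonneg A H ω)
  have hT0 : 0 ≤ ∑ ω, bernWeight p ω * containsInd A ω *
      (z ^ matchNum (inducedBy D ω) * noNeighborInd A H ω) :=
    Finset.sum_nonneg fun ω _ => mul_nonneg
      (mul_nonneg (bernWeight_nonneg hp ω) (containsInd_nonneg _ _))
      (mul_nonneg (pow_nonneg hz0 _) (noNeighborInd_nonneg A H ω))
  have hG0 := matchGen_nonneg hp hz0 H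
  rw [hind] at hharris
  rcases (pow_nonneg hp.1 A.card).eq_or_lt with h0 | hpos
  · have hs : 0 ≤ ∑ B ∈ H, if ¬ Disjoint A B then p ^ (A ∪ B).card else 0 :=
      Finset.sum_nonneg fun B _ => by
        split_ifs
        · exact le_rfl
        · exact pow_nonneg hp.1 _
    rw [← h0]
    exact (mul_nonpos_of_nonneg_of_nonpos hG0 (by linarith)).trans hT0
  · calc _ ≤ matchGen p z H * Q := mul_le_mul_of_nonneg_left hQ hG0
      _ ≤ matchGen p z D * Q := mul_le_mul_of_nonneg_right
          (matchGen_anti hp hz0 hz1 (Finset.filter_subset _ _)) hQ0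
      _ ≤ _ := le_of_mul_le_mul_left (by rw [← mul_assoc]; exact hharris) hpos

/-- Janson's inequality for the generating function of the matching number. -/
theorem matchGen_le_exp {p z : ℝ} (hp : p ∈ Set.Icc (0 : ℝ) 1) (hz0 : 0 ≤ z) (hz1 : z ≤ 1)
    (H : Finset (Finset V)) :
    matchGen p z H ≤ Real.exp (-(1 - z) * (muP p H - deltaP p H)) := by
  induction H using Finset.induction_on with
  | empty =>
    simp [matchGen, inducedBy, matchNum_empty, muP, deltaP, sum_bernWeight]
  | insert A H hA ih =>
    set d := p ^ A.card - ∑ B ∈ H, if ¬ Disjoint A B then p ^ (A ∪ B).card else 0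
    have hstep : matchGen p z (insert A H) ≤ matchGen p z H - (1 - z) * (matchGen p z H * d) := by
      have h1 := matchGen_mul_le_sum hp hz0 hz1 A H
      have h2 : matchGen p z (insert A H) ≤ matchGen p z H - (1 - z) *
          ∑ ω, bernWeight p ω * containsInd A ω *
            (z ^ matchNum (inducedBy (H.filter fun B => Disjoint A B) ω) *
              noNeighborInd A H ω) := by
        unfold matchGen
        rw [Finset.mul_sum, ← Finset.sum_sub_distrib]
        refine Finset.sum_le_sum fun ω _ => ?_
        have h3 := mul_le_mul_of_nonneg_left (pow_matchNum_insert_le hz0 hz1 hA ω)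
          (bernWeight_nonneg hp ω)
        refine h3.trans_eq ?_
        ring
      have h4 := mul_le_mul_of_nonneg_left h1 (sub_nonneg.2 hz1)
      linarith
    have hexp : 1 - (1 - z) * d ≤ Real.exp (-(1 - z) * d) := by
      linarith [Real.add_one_le_exp (-(1 - z) * d)]
    have hsum : muP p (insert A H) - deltaP p (insert A H) = (muP p H - deltaP p H) + d := by
      rw [deltaP_insert p hA, muP, Finset.sum_insert hA, ← muP]
      ring
    calc _ ≤ matchGen p z H * (1 - (1 - z) * d) := hstep.trans_eq (by ring)
      _ ≤ matchGen p z H * Real.exp (-(1 - z) * d) :=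
          mul_le_mul_of_nonneg_left hexp (matchGen_nonneg hp hz0 H)
      _ ≤ Real.exp (-(1 - z) * (muP p H - deltaP p H)) * Real.exp (-(1 - z) * d) :=
          mul_le_mul_of_nonneg_right ih (Real.exp_nonneg _)
      _ = _ := by rw [← Real.exp_add, hsum]; ring_nf

end Laplace

section Measure

theorem bern_singleton {p : ℝ} (b : Bool) :
    bern p {b} = ENNReal.ofReal (if b = true then p else 1 - p) := by
  cases b <;> simp [bern]

instance isFiniteMeasure_bern (p : ℝ) : IsFiniteMeasure (bern p) :=
  ⟨by simp [bern]⟩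

theorem pBern_apply {V : Type*} [Fintype V] [DecidableEq V] {p : ℝ} (hp : p ∈ Set.Icc (0 : ℝ) 1)
    (P : (V → Bool) → Prop) [DecidablePred P] :
    pBern V p {ω | P ω} = ENNReal.ofReal (∑ ω with P ω, bernWeight p ω) := by
  classical
  have hs : {ω | P ω} = (↑(Finset.univ.filter P) : Set (V → Bool)) := by ext; simp
  rw [hs, ← sum_measure_singleton, ENNReal.ofReal_sum_of_nonneg fun ω _ => bernWeight_nonneg hp ω]
  refine Finset.sum_congr rfl fun ω _ => ?_
  rw [pBern, Measure.pi_singleton, bernWeight, ENNReal.ofReal_prod_of_nonneg]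
  · exact Finset.prod_congr rfl fun v _ => bern_singleton _
  · intro v _
    split_ifs
    · exact hp.1
    · linarith [hp.2]

end Measure

theorem sq_mul_one_sub_log_sq_le {γ : ℝ} (hγ0 : 0 < γ) (hγ : γ ≤ 1 / 10) :
    γ ^ 2 * (1 - Real.log (γ ^ 2)) ≤ γ := by
  have h1 : -Real.log γ ≤ (10 * γ)⁻¹ - 1 + Real.log 10 := by
    have h := Real.log_le_sub_one_of_pos (x := (10 * γ)⁻¹) (by positivity)
    rw [Real.log_inv, Real.log_mul (by norm_num) hγ0.ne'] at h
    linarith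
  have h2 : Real.log 10 ≤ 4 := by
    have h : Real.log 10 ≤ Real.log (2 ^ 4) := Real.log_le_log (by norm_num) (by norm_num)
    rw [Real.log_pow] at h
    push_cast at h
    linarith [Real.log_two_lt_d9]
  have h3 : γ * (10 * γ)⁻¹ = 1 / 10 := by field_simp
  have h4 : γ * -Real.log γ ≤ γ * ((10 * γ)⁻¹ + 3) :=
    mul_le_mul_of_nonneg_left (by linarith) hγ0.le
  have h5 : γ * (1 - 2 * Real.log γ) ≤ 1 := by linarith
  have h6 := mul_le_mul_of_nonneg_left h5 hγ0.le
  rw [Real.log_pow]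
  push_cast
  linarith

theorem stmt3 {V : Type} [Fintype V] [DecidableEq V] (H : Finset (Finset V))
    (p γ : ℝ) (hp : p ∈ Set.Icc (0 : ℝ) 1) (hγ0 : 0 < γ) (hγ : γ ≤ 1 / 10)
    (μ Δ : ℝ) (hμ : μ = muP p H) (hΔ : Δ = deltaP p H) :
    pBern V p {ω | (matchNum (inducedBy H ω) : ℝ) ≤ γ ^ 2 * μ}
      ≤ ENNReal.ofReal (Real.exp (-(1 - γ) * μ + 2 * Δ)) := by
  classical
  have hz0 : 0 < γ ^ 2 := by positivity
  have hz1 : γ ^ 2 ≤ 1 := by nlinarith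
  have hμ0 : 0 ≤ μ := hμ ▸ Finset.sum_nonneg fun A _ => pow_nonneg hp.1 _
  have hΔ0 : 0 ≤ Δ := hΔ ▸ deltaP_nonneg hp.1 H
  rw [pBern_apply hp]
  refine ENNReal.ofReal_le_ofReal ?_
  set t := γ ^ 2 * μ with ht
  set L := Real.log (γ ^ 2) with hL
  have hpow : ∀ n : ℕ, (γ ^ 2) ^ n = Real.exp (L * n) := fun n => by
    rw [mul_comm, Real.exp_nat_mul, hL, Real.exp_log hz0]
  have hL0 : L ≤ 0 := Real.log_nonpos hz0.le hz1
  have hmarkov : (∑ ω with (matchNum (inducedBy H ω) : ℝ) ≤ t, bernWeight p ω) *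
      Real.exp (L * t) ≤ matchGen p (γ ^ 2) H := by
    rw [Finset.sum_mul]
    refine (Finset.sum_le_sum fun ω hω => ?_).trans (Finset.sum_le_sum_of_subset_of_nonneg
      (Finset.filter_subset _ _) fun ω _ _ =>
        mul_nonneg (bernWeight_nonneg hp ω) (pow_nonneg hz0.le _))
    refine mul_le_mul_of_nonneg_left ?_ (bernWeight_nonneg hp ω)
    rw [hpow]
    exact Real.exp_le_exp.2 (mul_le_mul_of_nonpos_left (Finset.mem_filter.1 hω).2 hL0)
  have hgen := matchGen_le_exp hp hz0.le hz1 H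
  rw [← hμ, ← hΔ] at hgen
  refine (le_div_iff₀ (Real.exp_pos _)).2 (hmarkov.trans hgen) |>.trans ?_
  rw [← Real.exp_sub]
  refine Real.exp_le_exp.2 ?_
  have hlog := mul_le_mul_of_nonneg_right (sq_mul_one_sub_log_sq_le hγ0 hγ) hμ0
  rw [← hL] at hlog
  have : 0 ≤ γ ^ 2 * Δ := by positivity
  rw [ht]
  linarith
end

section
/- Suppose p = p(n) ∈ [0,1] satisfies n·p/log n → ∞ as n → ∞. Then for every ζ > 0, asymptotically almost surely G ~ G_{n,p} satisfies the following simultaneously for every m and every tuple Π = (V_1,…,V_m) of pairwise disjoint subsets of its vertex set: |e(G ∩ ext(Π)) − |ext(Π)|·p| ≤ ζ·n²·p and |e(G ∩ int(Π)) − |int(Π)|·p| ≤ ζ·n²·p. -/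
open MeasureTheory Filter Topology

noncomputable def gnp (n : ℕ) (p : ℝ) : Measure (Sym2 (Fin n) → Bool) :=
  Measure.pi fun _ => bern p

/-- The binomial random graph `G_{n,p}`, as a function of the Bernoulli sample `ω`. -/
def graphOf {n : ℕ} (ω : Sym2 (Fin n) → Bool) : SimpleGraph (Fin n) :=
  SimpleGraph.fromEdgeSet {e | ω e = true}

/-- `ext(Π)`: the pairs of vertices meeting two distinct parts. -/
def extPairs {ι α : Type*} (S : ι → Set α) : Set (Sym2 α) :=
  {e | ∃ u v, e = s(u, v) ∧ ∃ i j, i ≠ j ∧ u ∈ S i ∧ v ∈ S j}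

/-- `int(Π)`: the pairs of distinct vertices contained in a single part. -/
def intPairs {ι α : Type*} (S : ι → Set α) : Set (Sym2 α) :=
  {e | ∃ u v, e = s(u, v) ∧ u ≠ v ∧ ∃ i, u ∈ S i ∧ v ∈ S i}

theorem isProbabilityMeasure_bern {p : ℝ} (hp : p ∈ Set.Icc (0 : ℝ) 1) :
    IsProbabilityMeasure (bern p) := by
  constructor
  simp only [bern, Measure.coe_add, Measure.coe_smul, Pi.add_apply, Pi.smul_apply, measure_univ,
    smul_eq_mul, mul_one]
  rw [← ENNReal.ofReal_add hp.1 (by linarith [hp.2])]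
  simp

theorem integral_bern {p : ℝ} (hp : p ∈ Set.Icc (0 : ℝ) 1) (f : Bool → ℝ) :
    ∫ b, f b ∂bern p = p * f true + (1 - p) * f false := by
  have hi (b : Bool) (c : ℝ) : Integrable f (ENNReal.ofReal c • Measure.dirac b) :=
    Integrable.smul_measure Integrable.of_finite ENNReal.ofReal_ne_top
  rw [bern, integral_add_measure (hi _ _) (hi _ _), integral_smul_measure, integral_smul_measure,
    integral_dirac, integral_dirac, ENNReal.toReal_ofReal hp.1,
    ENNReal.toReal_ofReal (by linarith [hp.2])]
  simp

theorem exp_bern_centered_le {p s : ℝ} (hp : p ∈ Set.Icc (0 : ℝ) 1) (hs : |s| ≤ 1) :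
    p * Real.exp (s * (1 - p)) + (1 - p) * Real.exp (s * (0 - p)) ≤ Real.exp (p * s ^ 2) := by
  have h1 : Real.exp s ≤ 1 + s + s ^ 2 := by
    have := (abs_le.mp (Real.abs_exp_sub_one_sub_id_le hs)).2
    linarith
  have h2 : 1 - p + p * Real.exp s ≤ Real.exp (p * s + p * s ^ 2) := by
    have := Real.add_one_le_exp (p * s + p * s ^ 2)
    nlinarith [hp.1]
  calc p * Real.exp (s * (1 - p)) + (1 - p) * Real.exp (s * (0 - p))
      = (1 - p + p * Real.exp s) * Real.exp (-(p * s)) := by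
        rw [show s * (1 - p) = s + -(p * s) by ring, show s * (0 - p) = -(p * s) by ring,
          Real.exp_add]
        ring
    _ ≤ Real.exp (p * s + p * s ^ 2) * Real.exp (-(p * s)) := by gcongr
    _ = Real.exp (p * s ^ 2) := by rw [← Real.exp_add]; ring_nf

/-- The number of chosen pairs in `F`, minus its expectation. -/
noncomputable def excess {n : ℕ} (p : ℝ) (F : Finset (Sym2 (Fin n)))
    (ω : Sym2 (Fin n) → Bool) : ℝ :=
  ∑ e ∈ F, ((if ω e = true then 1 else 0) - p)

theorem integral_exp_excess_le {n : ℕ} {p s : ℝ} (hp : p ∈ Set.Icc (0 : ℝ) 1) (hs : |s| ≤ 1)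
    (F : Finset (Sym2 (Fin n))) :
    ∫ ω, Real.exp (s * excess p F ω) ∂gnp n p ≤ Real.exp ((n : ℝ) ^ 2 * p * s ^ 2) := by
  classical
  have := isProbabilityMeasure_bern hp
  let f : Sym2 (Fin n) → Bool → ℝ := fun e b =>
    if e ∈ F then Real.exp (s * ((if b = true then 1 else 0) - p)) else 1
  have hprod (ω : Sym2 (Fin n) → Bool) :
      Real.exp (s * excess p F ω) = ∏ e, f e (ω e) := by
    simp only [f, Finset.prod_ite_mem, Finset.univ_inter]
    rw [excess, Finset.mul_sum, Real.exp_sum]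
  rw [integral_congr_ae (ae_of_all _ hprod), gnp, integral_fintype_prod_eq_prod (f := f)]
  have hcard : (Fintype.card (Sym2 (Fin n)) : ℝ) ≤ (n : ℝ) ^ 2 := by
    have : Fintype.card (Sym2 (Fin n)) ≤ n ^ 2 := by
      have := Fintype.card_le_of_surjective (fun x : Fin n × Fin n => s(x.1, x.2))
        fun e => e.ind fun u v => ⟨(u, v), rfl⟩
      simpa only [sq, Fintype.card_prod, Fintype.card_fin] using this
    exact_mod_cast this
  calc _ ≤ ∏ _e : Sym2 (Fin n), Real.exp (p * s ^ 2) := by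
        refine Finset.prod_le_prod (fun e _ => integral_nonneg fun b => ?_) fun e _ => ?_
        · simp only [f, Pi.zero_apply]; split_ifs <;> positivity
        · rw [integral_bern hp]
          by_cases he : e ∈ F
          · simpa [f, he] using exp_bern_centered_le hp hs
          · simpa [f, he] using mul_nonneg hp.1 (sq_nonneg s)
    _ = Real.exp (Fintype.card (Sym2 (Fin n)) * (p * s ^ 2)) := by
        rw [Finset.prod_const, Finset.card_univ, ← Real.exp_nat_mul]
    _ ≤ Real.exp ((n : ℝ) ^ 2 * p * s ^ 2) := by
        rw [mul_assoc]
        have := mul_nonneg hp.1 (sq_nonneg s)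
        gcongr

theorem isProbabilityMeasure_gnp {n : ℕ} {p : ℝ} (hp : p ∈ Set.Icc (0 : ℝ) 1) :
    IsProbabilityMeasure (gnp n p) := by
  have := isProbabilityMeasure_bern hp
  unfold gnp
  infer_instance

theorem measureReal_le_mul_excess_le {n : ℕ} {p s a : ℝ} (hp : p ∈ Set.Icc (0 : ℝ) 1)
    (hs : |s| ≤ 1) (F : Finset (Sym2 (Fin n))) :
    (gnp n p).real {ω | a ≤ s * excess p F ω} ≤ Real.exp ((n : ℝ) ^ 2 * p * s ^ 2 - a) := by
  have := isProbabilityMeasure_gnp (n := n) hp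
  have h := mul_meas_ge_le_integral_of_nonneg (μ := gnp n p)
    (f := fun ω => Real.exp (s * excess p F ω)) (ae_of_all _ fun _ => (Real.exp_pos _).le)
    Integrable.of_finite (Real.exp a)
  simp only [Real.exp_le_exp] at h
  rw [Real.exp_sub, le_div_iff₀ (Real.exp_pos a), mul_comm]
  exact h.trans (integral_exp_excess_le hp hs F)

theorem measureReal_lt_abs_excess_le {n : ℕ} {p t ζ : ℝ} (hp : p ∈ Set.Icc (0 : ℝ) 1)
    (ht0 : 0 ≤ t) (ht1 : t ≤ 1) (F : Finset (Sym2 (Fin n))) :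
    (gnp n p).real {ω | ζ * (n : ℝ) ^ 2 * p < |excess p F ω|} ≤
      2 * Real.exp ((n : ℝ) ^ 2 * p * (t ^ 2 - t * ζ)) := by
  have := isProbabilityMeasure_gnp (n := n) hp
  set a := t * (ζ * (n : ℝ) ^ 2 * p) with ha
  have hsub : {ω | ζ * (n : ℝ) ^ 2 * p < |excess p F ω|} ⊆
      {ω | a ≤ t * excess p F ω} ∪ {ω | a ≤ -t * excess p F ω} := by
    intro ω hω
    rcases lt_abs.mp (Set.mem_ofPred_eq ▸ hω) with h | h
    · exact Or.inl (mul_le_mul_of_nonneg_left h.le ht0)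
    · right
      have := mul_le_mul_of_nonneg_left h.le ht0
      simp only [Set.mem_ofPred_eq]
      linarith
  have h1 := measureReal_le_mul_excess_le (a := a) hp (abs_le.mpr ⟨by linarith, ht1⟩) F
  have h2 := measureReal_le_mul_excess_le (s := -t) (a := a) hp
    (abs_le.mpr ⟨by linarith, by linarith⟩) F
  have h3 := (measureReal_mono hsub (by finiteness)).trans
    (measureReal_union_le (μ := gnp n p) _ _)
  have e : (n : ℝ) ^ 2 * p * (t ^ 2 - t * ζ) = (n : ℝ) ^ 2 * p * t ^ 2 - a := by rw [ha]; ring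
  rw [neg_sq] at h2
  rw [e]
  linarith

theorem card_edgeSet_inter_sub_eq_excess {n : ℕ} (p : ℝ) (F : Finset (Sym2 (Fin n)))
    (hF : ∀ e ∈ F, ¬ e.IsDiag) (ω : Sym2 (Fin n) → Bool) :
    (Nat.card ((graphOf ω).edgeSet ∩ F : Set (Sym2 (Fin n))) : ℝ)
      - (Nat.card (F : Set (Sym2 (Fin n))) : ℝ) * p = excess p F ω := by
  classical
  have h : (graphOf ω).edgeSet ∩ F = (F.filter fun e => ω e = true : Finset (Sym2 (Fin n))) := by
    ext e
    simp only [graphOf, SimpleGraph.edgeSet_fromEdgeSet, Set.mem_inter_iff, Set.mem_sdiff,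
      Set.mem_ofPred_eq, Finset.coe_filter, Finset.mem_coe]
    have := hF e
    rw [← Sym2.mem_diagSet] at this
    grind
  rw [h, excess]
  simp [Finset.sum_sub_distrib]

theorem not_isDiag_of_mem_extPairs {ι α : Type*} {S : ι → Set α}
    (hS : ∀ i j, i ≠ j → Disjoint (S i) (S j)) {e : Sym2 α} (he : e ∈ extPairs S) :
    ¬ e.IsDiag := by
  obtain ⟨u, v, rfl, i, j, hij, hu, hv⟩ := he
  rw [Sym2.mk_isDiag_iff]
  rintro rfl
  exact Set.disjoint_left.mp (hS i j hij) hu hv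

theorem not_isDiag_of_mem_intPairs {ι α : Type*} {S : ι → Set α} {e : Sym2 α}
    (he : e ∈ intPairs S) : ¬ e.IsDiag := by
  obtain ⟨u, v, rfl, huv, -⟩ := he
  exact huv

/-- The fibres of `g` over the points other than `⊤`. -/
def fibers {n : ℕ} (g : Fin n → WithTop (Fin n)) (x : Fin n) : Set (Fin n) :=
  {v | g v = x}

/-- Labelling every vertex by the least vertex of its part encodes a tuple of disjoint sets,
of arbitrary length, by one of `(n + 1) ^ n` functions. -/
theorem exists_fibers_pairs_eq {n m : ℕ} (P : Fin m → Finset (Fin n))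
    (hP : ∀ i j, i ≠ j → Disjoint (P i) (P j)) :
    ∃ g : Fin n → WithTop (Fin n),
      extPairs (fun i => (P i : Set (Fin n))) = extPairs (fibers g) ∧
      intPairs (fun i => (P i : Set (Fin n))) = intPairs (fibers g) := by
  classical
  have huniq {v i j} (hi : v ∈ P i) (hj : v ∈ P j) : i = j := by
    by_contra h
    exact Finset.disjoint_left.mp (hP i j h) hi hj
  let g : Fin n → WithTop (Fin n) := fun v =>
    (Finset.univ.filter fun w => ∃ i, v ∈ P i ∧ w ∈ P i).min
  have hg {v x} (h : g v = (x : Fin n)) : ∃ i, v ∈ P i ∧ x ∈ P i := by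
    simpa using Finset.mem_of_min h
  have hgP {v i} (h : v ∈ P i) : g v = (P i).min := by
    simp only [g]
    congr 1
    ext w
    simp only [Finset.mem_filter, Finset.mem_univ, true_and]
    exact ⟨fun ⟨j, hj, hw⟩ => huniq hj h ▸ hw, fun hw => ⟨i, h, hw⟩⟩
  have hlabel {v i} (h : v ∈ P i) : ∃ x : Fin n, g v = x ∧ x ∈ P i := by
    obtain ⟨x, hx⟩ := Finset.min_of_mem h
    exact ⟨x, (hgP h).trans hx, Finset.mem_of_min hx⟩
  refine ⟨g, Set.ext fun e => ⟨?_, ?_⟩, Set.ext fun e => ⟨?_, ?_⟩⟩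
  · rintro ⟨u, v, rfl, i, j, hij, hu, hv⟩
    obtain ⟨x, hx, hxi⟩ := hlabel hu
    obtain ⟨y, hy, hyj⟩ := hlabel hv
    exact ⟨u, v, rfl, x, y, fun h => hij (huniq hxi (h ▸ hyj)), hx, hy⟩
  · rintro ⟨u, v, rfl, x, y, hxy, hu, hv⟩
    obtain ⟨i, hui, hxi⟩ := hg hu
    obtain ⟨j, hvj, hyj⟩ := hg hv
    refine ⟨u, v, rfl, i, j, ?_, hui, hvj⟩
    rintro rfl
    have h : (x : WithTop (Fin n)) = y := by
      rw [← show g u = x from hu, ← show g v = y from hv, hgP hui, hgP hvj]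
    exact hxy (WithTop.coe_injective h)
  · rintro ⟨u, v, rfl, huv, i, hu, hv⟩
    obtain ⟨x, hx, hxi⟩ := hlabel hu
    exact ⟨u, v, rfl, huv, x, hx, (hgP hv).trans ((hgP hu).symm.trans hx)⟩
  · rintro ⟨u, v, rfl, huv, x, hu, hv⟩
    obtain ⟨i, hui, hxi⟩ := hg hu
    obtain ⟨j, hvj, hxj⟩ := hg hv
    exact ⟨u, v, rfl, huv, i, hui, huniq hxj hxi ▸ hvj⟩

/-- The union bound over a finite family of pair sets. -/
theorem measureReal_exists_lt_abs_excess_le {n : ℕ} {p t ζ : ℝ} (hp : p ∈ Set.Icc (0 : ℝ) 1)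
    (ht0 : 0 ≤ t) (ht1 : t ≤ 1) {κ : Type*} [Fintype κ] (F : κ → Finset (Sym2 (Fin n))) :
    (gnp n p).real {ω | ∃ k, ζ * (n : ℝ) ^ 2 * p < |excess p (F k) ω|} ≤
      Fintype.card κ * (2 * Real.exp ((n : ℝ) ^ 2 * p * (t ^ 2 - t * ζ))) := by
  rw [Set.ofPred_exists]
  refine (measureReal_iUnion_fintype_le _).trans ?_
  refine (Finset.sum_le_card_nsmul _ _ _ fun k _ =>
    measureReal_lt_abs_excess_le hp ht0 ht1 (F k)).trans ?_
  rw [nsmul_eq_mul, Finset.card_univ]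

theorem tendsto_union_bound {p : ℕ → ℝ}
    (hgrow : Tendsto (fun n : ℕ => (n : ℝ) * p n / Real.log n) atTop atTop)
    {c : ℝ} (hc : 0 < c) :
    Tendsto (fun n : ℕ => 2 * ((n : ℝ) + 1) ^ n * (2 * Real.exp ((n : ℝ) ^ 2 * p n * (-c))))
      atTop (𝓝 0) := by
  have hlim : Tendsto (fun n : ℕ => 4 * Real.exp (-(n * Real.log n))) atTop (𝓝 0) := by
    have h := Real.tendsto_exp_neg_atTop_nhds_zero.comp
      (tendsto_natCast_atTop_atTop.atTop_mul_atTop₀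
        (Real.tendsto_log_atTop.comp (tendsto_natCast_atTop_atTop (R := ℝ))))
    simpa using h.const_mul 4
  refine squeeze_zero' (Eventually.of_forall fun n => by positivity) ?_ hlim
  filter_upwards [hgrow.eventually_ge_atTop (3 / c), eventually_ge_atTop 2] with n hn hn2
  have hn2' : (2 : ℝ) ≤ n := by exact_mod_cast hn2
  have hlog : 0 < Real.log n := Real.log_pos (by linarith)
  have hnp : 3 * Real.log n ≤ n * p n * c := by
    rw [div_le_div_iff₀ hc hlog] at hn
    exact hn
  have hpow : ((n : ℝ) + 1) ^ n ≤ Real.exp (2 * (n * Real.log n)) := by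
    calc ((n : ℝ) + 1) ^ n ≤ ((n : ℝ) ^ 2) ^ n := by
          gcongr
          nlinarith
      _ = Real.exp (2 * (n * Real.log n)) := by
          rw [show 2 * (n * Real.log n) = n * (2 * Real.log n) by ring, Real.exp_nat_mul,
            two_mul, Real.exp_add, Real.exp_log (by linarith), sq]
  have hexp : Real.exp ((n : ℝ) ^ 2 * p n * (-c)) ≤ Real.exp (-(3 * (n * Real.log n))) := by
    apply Real.exp_le_exp.mpr
    nlinarith [mul_le_mul_of_nonneg_left hnp (by linarith : (0 : ℝ) ≤ n)]
  calc 2 * ((n : ℝ) + 1) ^ n * (2 * Real.exp ((n : ℝ) ^ 2 * p n * (-c)))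
      ≤ 2 * Real.exp (2 * (n * Real.log n)) * (2 * Real.exp (-(3 * (n * Real.log n)))) := by
        gcongr
    _ = 4 * (Real.exp (2 * (n * Real.log n)) * Real.exp (-(3 * (n * Real.log n)))) := by ring
    _ = 4 * Real.exp (-(n * Real.log n)) := by rw [← Real.exp_add]; ring_nf

theorem stmt7 (p : ℕ → ℝ) (hp : ∀ n, p n ∈ Set.Icc (0 : ℝ) 1)
    (hgrow : Filter.Tendsto (fun n : ℕ => (n : ℝ) * p n / Real.log n) atTop atTop)
    (ζ : ℝ) (hζ : 0 < ζ) :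
    Filter.Tendsto
      (fun n : ℕ => gnp n (p n)
        {ω | ∀ m : ℕ, ∀ P : Fin m → Finset (Fin n),
          (∀ i j, i ≠ j → Disjoint (P i) (P j)) →
          |(Nat.card ((graphOf ω).edgeSet ∩ extPairs (fun i => (↑(P i) : Set (Fin n)))
                : Set (Sym2 (Fin n))) : ℝ)
              - (Nat.card (extPairs (fun i => (↑(P i) : Set (Fin n)))) : ℝ) * p n|
            ≤ ζ * (n : ℝ) ^ 2 * p n ∧
          |(Nat.card ((graphOf ω).edgeSet ∩ intPairs (fun i => (↑(P i) : Set (Fin n)))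
                : Set (Sym2 (Fin n))) : ℝ)
              - (Nat.card (intPairs (fun i => (↑(P i) : Set (Fin n)))) : ℝ) * p n|
            ≤ ζ * (n : ℝ) ^ 2 * p n})
      atTop (nhds 1) := by
  classical
  set t := min 1 (ζ / 2) with ht
  have ht0 : 0 < t := lt_min one_pos (by positivity)
  have htζ : t ≤ ζ / 2 := min_le_right _ _
  have hc : 0 < t * ζ - t ^ 2 := by nlinarith
  have hb := tendsto_union_bound hgrow hc
  have hlow := ENNReal.tendsto_ofReal (hb.const_sub 1)
  rw [sub_zero, ENNReal.ofReal_one] at hlow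
  have hprob (n : ℕ) := isProbabilityMeasure_gnp (n := n) (hp n)
  refine tendsto_of_tendsto_of_tendsto_of_le_of_le hlow tendsto_const_nhds (fun n => ?_)
    fun n => prob_le_one
  let F : (Fin n → WithTop (Fin n)) × Bool → Finset (Sym2 (Fin n)) := fun k =>
    if k.2 then (extPairs (fibers k.1)).toFinset else (intPairs (fibers k.1)).toFinset
  set bad := {ω | ∃ k, ζ * (n : ℝ) ^ 2 * p n < |excess (p n) (F k) ω|} with hbad
  have hcard : (Fintype.card ((Fin n → WithTop (Fin n)) × Bool) : ℝ) = 2 * ((n : ℝ) + 1) ^ n := by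
    have : Fintype.card (WithTop (Fin n)) = n + 1 := by
      exact (Fintype.card_option (α := Fin n)).trans (by rw [Fintype.card_fin])
    simp [this, mul_comm]
  have hle : 1 - 2 * ((n : ℝ) + 1) ^ n *
      (2 * Real.exp ((n : ℝ) ^ 2 * p n * (-(t * ζ - t ^ 2)))) ≤ (gnp n (p n)).real badᶜ := by
    have h := measureReal_exists_lt_abs_excess_le (ζ := ζ) (hp n) ht0.le (min_le_left _ _) F
    rw [probReal_compl_eq_one_sub (Set.toFinite _).measurableSet, neg_sub, ← hcard]
    linarith
  refine (ENNReal.ofReal_le_of_le_toReal hle).trans (measure_mono ?_)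
  intro ω hω m P hP
  simp only [hbad, Set.mem_compl_iff, Set.mem_ofPred_eq, not_exists, not_lt] at hω
  obtain ⟨g, hext, hint⟩ := exists_fibers_pairs_eq P hP
  have hdiag : ∀ e ∈ extPairs (fibers g), ¬ e.IsDiag := fun e he =>
    not_isDiag_of_mem_extPairs (S := fun i => (P i : Set (Fin n)))
      (fun i j hij => Finset.disjoint_coe.mpr (hP i j hij)) (hext ▸ he)
  rw [hext, hint]
  constructor
  · have h := card_edgeSet_inter_sub_eq_excess (p n) (F (g, true))
      (fun e he => hdiag e (by simpa [F] using he)) ω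
    have hF : (F (g, true) : Set (Sym2 (Fin n))) = extPairs (fibers g) := by simp [F]
    rw [hF] at h
    rw [h]
    exact hω _
  · have h := card_edgeSet_inter_sub_eq_excess (p n) (F (g, false))
      (fun e he => not_isDiag_of_mem_intPairs (S := fibers g) (by simpa [F] using he)) ω
    have hF : (F (g, false) : Set (Sym2 (Fin n))) = intPairs (fibers g) := by simp [F]
    rw [hF] at h
    rw [h]
    exact hω _
end
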